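/- Identity principle for slice regular functions: Let f, g : Ω → ℍ be slice regular functions on a slice domain Ω. If f and g coincide on a subset T ⊆ Ω and there exists I ∈ 𝕊 such that T ∩ L_I has an accumulation point belonging to Ω_I = Ω ∩ L_I, then f and g coincide on all of Ω. -/

import Mathlib

open scoped Quaternion

/-- The sphere of imaginary units in the quaternions. -/
def qSphere : Set ℍ[ℝ] := {q : ℍ[ℝ] | q.re = 0 ∧ ‖q‖ = 1}

/-- The point of the slice `L_I = ℝ + ℝI` corresponding to `z = x + iy ∈ ℂ`. -/
noncomputable def toSlice (I : ℍ[ℝ]) (z : ℂ) : ℍ[ℝ] := (z.re : ℍ[ℝ]) + z.im • I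

/-- `f` is slice regular on `Ω`: for each imaginary unit `I`, the restriction of `f` to
`Ω ∩ L_I`, read through the parametrization `toSlice I : ℂ → L_I`, is real differentiable
and satisfies the Cauchy–Riemann equation `∂f/∂x + I ∂f/∂y = 0`. -/
def SliceRegularOn (f : ℍ[ℝ] → ℍ[ℝ]) (Ω : Set ℍ[ℝ]) : Prop :=
  ∀ I ∈ qSphere, ∀ z : ℂ, toSlice I z ∈ Ω →
    ∃ D : ℂ →L[ℝ] ℍ[ℝ],
      HasFDerivWithinAt (fun w => f (toSlice I w)) D (toSlice I ⁻¹' Ω) z ∧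
      D 1 + I * D Complex.I = 0

/-- A slice domain: a domain meeting the real axis all of whose slices are domains. -/
def IsSliceDomain (Ω : Set ℍ[ℝ]) : Prop :=
  IsOpen Ω ∧ IsConnected Ω ∧ (∃ x : ℝ, (x : ℍ[ℝ]) ∈ Ω) ∧
  ∀ I ∈ qSphere, IsConnected (toSlice I ⁻¹' Ω)

/-- `cos θ + I sin θ`. -/
noncomputable def expI (I : ℍ[ℝ]) (θ : ℝ) : ℍ[ℝ] := (Real.cos θ : ℍ[ℝ]) + Real.sin θ • I

/-- The circular cone of opening `φ` around the positive real axis. -/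
def circularCone (φ : ℝ) : Set ℍ[ℝ] :=
  {q : ℍ[ℝ] | ∃ r θ : ℝ, ∃ I ∈ qSphere, 0 < r ∧ |θ| < φ / 2 ∧ q = r • expI I θ}

/-- `M_f(r)`: the maximum of `‖f‖` on the closure of `Ω` intersected with the sphere of radius `r`. -/
noncomputable def maxMod (f : ℍ[ℝ] → ℍ[ℝ]) (Ω : Set ℍ[ℝ]) (r : ℝ) : ℝ :=
  sSup ((fun q => ‖f q‖) '' (closure Ω ∩ Metric.sphere (0 : ℍ[ℝ]) r))

/-- The order of a slice regular function. -/
noncomputable def growthOrder (f : ℍ[ℝ] → ℍ[ℝ]) (Ω : Set ℍ[ℝ]) : EReal :=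
  Filter.limsup (fun r : ℝ =>
    ((max 0 (Real.log (max 0 (Real.log (maxMod f Ω r)))) / Real.log r : ℝ) : EReal))
    Filter.atTop

/-- The type of a slice regular function of order `ρ`. -/
noncomputable def growthType (f : ℍ[ℝ] → ℍ[ℝ]) (Ω : Set ℍ[ℝ]) (ρ : ℝ) : EReal :=
  Filter.limsup (fun r : ℝ => ((max 0 (Real.log (maxMod f Ω r)) / r ^ ρ : ℝ) : EReal))
    Filter.atTop

/-- The angle of opening `φ` bisected by the half line of argument `ζ` in the slice `L_I`. -/
def angleSet (I : ℍ[ℝ]) (ζ φ : ℝ) : Set ℍ[ℝ] :=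
  {q : ℍ[ℝ] | ∃ r θ : ℝ, 0 < r ∧ |θ| < φ / 2 ∧ q = r • expI I (ζ + θ)}

/-- The real affine line through `p` with direction `d`. -/
def lineSet (p d : ℍ[ℝ]) : Set ℍ[ℝ] := {q : ℍ[ℝ] | ∃ t : ℝ, q = p + t • d}

/-- `f` is slice preserving: it maps each slice into itself. -/
def SlicePreservingOn (f : ℍ[ℝ] → ℍ[ℝ]) (Ω : Set ℍ[ℝ]) : Prop :=
  ∀ I ∈ qSphere, ∀ q ∈ Ω ∩ Set.range (toSlice I), f q ∈ Set.range (toSlice I)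

/-- The principal quaternionic logarithm. -/
noncomputable def QLog (q : ℍ[ℝ]) : ℍ[ℝ] :=
  (Real.log ‖q‖ : ℍ[ℝ]) + Real.arccos (q.re / ‖q‖) • (‖q.im‖⁻¹ • q.im)

theorem toSlice_one (I : ℍ[ℝ]) : toSlice I 1 = 1 := by
  simp [toSlice]

theorem toSlice_I (I : ℍ[ℝ]) : toSlice I Complex.I = I := by
  simp [toSlice]

theorem toSlice_ofReal (I : ℍ[ℝ]) (x : ℝ) : toSlice I x = x := by
  simp [toSlice]

theorem toSlice_add (I : ℍ[ℝ]) (z w : ℂ) : toSlice I (z + w) = toSlice I z + toSlice I w := by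
  simp only [toSlice, Complex.add_re, Complex.add_im, Quaternion.coe_add, add_smul]
  abel

theorem continuous_toSlice (I : ℍ[ℝ]) : Continuous (toSlice I) :=
  (Quaternion.continuous_coe.comp Complex.continuous_re).add
    (Complex.continuous_im.smul continuous_const)

theorem sum_sq_of_mem_qSphere {I : ℍ[ℝ]} (hI : I ∈ qSphere) :
    I.imI ^ 2 + I.imJ ^ 2 + I.imK ^ 2 = 1 := by
  have h := Quaternion.normSq_eq_norm_mul_self I
  rw [Quaternion.normSq_def', hI.1, hI.2] at h
  linarith

theorem mul_self_of_mem_qSphere {I : ℍ[ℝ]} (hI : I ∈ qSphere) : I * I = -1 := by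
  have h := sum_sq_of_mem_qSphere hI
  have h0 := hI.1
  ext <;> simp [h0] <;> linarith

theorem toSlice_mul {I : ℍ[ℝ]} (hI : I ∈ qSphere) (z w : ℂ) :
    toSlice I (z * w) = toSlice I z * toSlice I w := by
  have h := sum_sq_of_mem_qSphere hI
  have h0 := hI.1
  ext <;> simp [toSlice, h0]
  · linear_combination (z.im * w.im) * h
  all_goals ring

theorem norm_toSlice {I : ℍ[ℝ]} (hI : I ∈ qSphere) (z : ℂ) : ‖toSlice I z‖ = ‖z‖ := by
  have h := sum_sq_of_mem_qSphere hI
  have h0 := hI.1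
  rw [← sq_eq_sq₀ (norm_nonneg _) (norm_nonneg _), sq, ← Quaternion.normSq_eq_norm_mul_self,
    Quaternion.normSq_def', Complex.sq_norm, Complex.normSq_apply]
  simp [toSlice, h0]
  linear_combination z.im ^ 2 * h

/-- The complex normed space structure on `ℍ` given by left multiplication by elements of the
slice `L_I`. -/
noncomputable abbrev sliceNormedSpace (I : ℍ[ℝ]) (hI : I ∈ qSphere) : NormedSpace ℂ ℍ[ℝ] where
  smul z q := toSlice I z * q
  one_smul q := show toSlice I 1 * q = q by rw [toSlice_one, one_mul]
  mul_smul z w q := show toSlice I (z * w) * q = toSlice I z * (toSlice I w * q) by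
    rw [toSlice_mul hI, mul_assoc]
  smul_zero z := mul_zero _
  smul_add z := mul_add _
  add_smul z w q := show toSlice I (z + w) * q = toSlice I z * q + toSlice I w * q by
    rw [toSlice_add, add_mul]
  zero_smul q := show toSlice I 0 * q = 0 by simp [toSlice]
  norm_smul_le z q := show ‖toSlice I z * q‖ ≤ ‖z‖ * ‖q‖ by
    rw [norm_mul, norm_toSlice hI]

theorem map_eq_toSlice_mul {I : ℍ[ℝ]} (hI : I ∈ qSphere) (D : ℂ →L[ℝ] ℍ[ℝ])
    (hD : D 1 + I * D Complex.I = 0) (z : ℂ) : D z = toSlice I z * D 1 := by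
  have hDI : D Complex.I = I * D 1 := by
    rw [eq_neg_of_add_eq_zero_left hD, mul_neg, ← mul_assoc, mul_self_of_mem_qSphere hI]
    simp
  have hz : z = z.re • (1 : ℂ) + z.im • Complex.I := by
    simp [Complex.re_add_im]
  conv_lhs => rw [hz, map_add, map_smul, map_smul, hDI]
  rw [toSlice, add_mul, Quaternion.coe_mul_eq_smul, smul_mul_assoc]

theorem SliceRegularOn.differentiableOn {f : ℍ[ℝ] → ℍ[ℝ]} {Ω : Set ℍ[ℝ]}
    (hf : SliceRegularOn f Ω) {I : ℍ[ℝ]} (hI : I ∈ qSphere) :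
    letI := sliceNormedSpace I hI
    DifferentiableOn ℂ (fun w => f (toSlice I w)) (toSlice I ⁻¹' Ω) := by
  let := sliceNormedSpace I hI
  intro z hz
  obtain ⟨D, hD, hCR⟩ := hf I hI z hz
  refine HasDerivWithinAt.differentiableWithinAt (f' := D 1) ?_
  rw [hasDerivWithinAt_iff_isLittleO]
  refine (hasFDerivWithinAt_iff_isLittleO.1 hD).congr_left fun w => ?_
  rw [map_eq_toSlice_mul hI D hCR]
  rfl

theorem SliceRegularOn.eqOn_slice {f g : ℍ[ℝ] → ℍ[ℝ]} {Ω : Set ℍ[ℝ]}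
    (hf : SliceRegularOn f Ω) (hg : SliceRegularOn g Ω) (hΩ : IsOpen Ω)
    {I : ℍ[ℝ]} (hI : I ∈ qSphere) (hconn : IsPreconnected (toSlice I ⁻¹' Ω))
    {z : ℂ} (hz : toSlice I z ∈ Ω)
    (hfg : ∃ᶠ w in nhdsWithin z {z}ᶜ, f (toSlice I w) = g (toSlice I w)) :
    Set.EqOn (fun w => f (toSlice I w)) (fun w => g (toSlice I w)) (toSlice I ⁻¹' Ω) := by
  let := sliceNormedSpace I hI
  have ho := hΩ.preimage (continuous_toSlice I)
  exact ((hf.differentiableOn hI).analyticOnNhd ho).eqOn_of_preconnected_of_frequently_eq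
    ((hg.differentiableOn hI).analyticOnNhd ho) hconn hz hfg

theorem exists_toSlice_eq {I : ℍ[ℝ]} (hI : I ∈ qSphere) (q : ℍ[ℝ]) :
    ∃ J ∈ qSphere, ∃ z, toSlice J z = q := by
  by_cases hq : q.im = 0
  · exact ⟨I, hI, q.re, by rw [toSlice_ofReal]; simpa [hq] using q.re_add_im⟩
  · have hn : ‖q.im‖ ≠ 0 := norm_ne_zero_iff.2 hq
    refine ⟨‖q.im‖⁻¹ • q.im, ⟨by simp, ?_⟩, ⟨q.re, ‖q.im‖⟩, ?_⟩
    · rw [norm_smul, norm_inv, norm_norm, inv_mul_cancel₀ hn]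
    · simp only [toSlice]
      rw [smul_inv_smul₀ hn, q.re_add_im]

theorem frequently_of_accPt_toSlice {I : ℍ[ℝ]} (hI : I ∈ qSphere) {T : Set ℍ[ℝ]} {z : ℂ}
    (h : AccPt (toSlice I z) (Filter.principal (T ∩ Set.range (toSlice I)))) :
    ∃ᶠ w in nhdsWithin z {z}ᶜ, toSlice I w ∈ T := by
  have hiso : Isometry (toSlice I) :=
    Isometry.of_dist_eq fun z w => by
      have hsub : toSlice I z = toSlice I (z - w) + toSlice I w := by
        rw [← toSlice_add, sub_add_cancel]
      rw [dist_eq_norm, dist_eq_norm, hsub, add_sub_cancel_right, norm_toSlice hI]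
  rw [accPt_iff_frequently, Metric.nhds_basis_ball.frequently_iff] at h
  rw [frequently_nhdsWithin_iff, Metric.nhds_basis_ball.frequently_iff]
  intro ε hε
  obtain ⟨_, hd, hne, hT, w, rfl⟩ := h ε hε
  exact ⟨w, by rwa [Metric.mem_ball, ← hiso.dist_eq], hT, fun hw => hne (congrArg _ hw)⟩

theorem frequently_ofReal_nhdsNE (x : ℝ) {p : ℂ → Prop}
    (h : ∀ᶠ y : ℝ in nhds x, p y) : ∃ᶠ w in nhdsWithin (x : ℂ) {(x : ℂ)}ᶜ, p w := by
  have ht : Filter.Tendsto ((↑) : ℝ → ℂ) (nhdsWithin x {x}ᶜ) (nhdsWithin (x : ℂ) {(x : ℂ)}ᶜ) :=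
    Complex.continuous_ofReal.continuousWithinAt.tendsto_nhdsWithin fun y hy => by
      simpa using hy
  exact ht.frequently (h.filter_mono nhdsWithin_le_nhds).frequently

/-- Identity principle for slice regular functions. -/
theorem identity_principle
    (Ω : Set ℍ[ℝ]) (hΩ : IsSliceDomain Ω)
    (f g : ℍ[ℝ] → ℍ[ℝ]) (hf : SliceRegularOn f Ω) (hg : SliceRegularOn g Ω)
    (T : Set ℍ[ℝ]) (hT : T ⊆ Ω) (heq : ∀ q ∈ T, f q = g q)
    (I : ℍ[ℝ]) (hI : I ∈ qSphere)
    (p : ℍ[ℝ]) (hpΩ : p ∈ Ω) (hpL : p ∈ Set.range (toSlice I))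
    (hacc : AccPt p (Filter.principal (T ∩ Set.range (toSlice I)))) :
    ∀ q ∈ Ω, f q = g q := by
  obtain ⟨hopen, -, ⟨x, hx⟩, hconn⟩ := hΩ
  obtain ⟨z, rfl⟩ := hpL
  have hslice := hf.eqOn_slice hg hopen hI (hconn I hI).isPreconnected hpΩ
    ((frequently_of_accPt_toSlice hI hacc).mono fun w hw => heq _ hw)
  have hreal : ∀ᶠ y : ℝ in nhds x, f y = g y := by
    filter_upwards [(hopen.preimage Quaternion.continuous_coe).mem_nhds hx] with y hy
    have := @hslice (y : ℂ) (by rwa [Set.mem_preimage, toSlice_ofReal])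
    simpa only [toSlice_ofReal] using this
  intro q hq
  obtain ⟨J, hJ, w, rfl⟩ := exists_toSlice_eq hI q
  refine hf.eqOn_slice hg hopen hJ (hconn J hJ).isPreconnected (z := x) ?_ ?_ hq
  · rwa [toSlice_ofReal]
  · exact frequently_ofReal_nhdsNE x (by simpa only [toSlice_ofReal] using hreal)
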